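/- arXiv:2311.15915 — 2 statements merged into one kernel-verified Lean document; each statement's English description precedes it below -/
import Mathlib

section
/- Let T > 0 and let p = Σ_{j=0}^{N} p_j δ_{-λ_j} with p_j ∈ ℝ and pairwise distinct λ_j ∈ [0, T], and assume p_j λ_j ≠ 0 for some j (i.e. p ≠ 0 and the support of p is not reduced to {0}); in particular the coefficient of the atom of p at the leftmost point of its support is nonzero. Then p is invertible with respect to convolution in the algebra M_+(ℝ) of Radon measures on ℝ whose support is bounded on the left: there exists p^{-1} ∈ M_+(ℝ) with p * p^{-1} = δ_0. -/
open MeasureTheory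

/-- The positive part `∑_{j : p j > 0} (p j) δ_{-λ_j}` of the measure `∑ j, p j δ_{-λ_j}`. -/
noncomputable def diracCombPos {n : ℕ} (p lam : Fin n → ℝ) : Measure ℝ :=
  ∑ j : Fin n, ENNReal.ofReal (p j) • Measure.dirac (-(lam j))

/-- The negative part `∑_{j : p j < 0} (-p j) δ_{-λ_j}` of the measure `∑ j, p j δ_{-λ_j}`. -/
noncomputable def diracCombNeg {n : ℕ} (p lam : Fin n → ℝ) : Measure ℝ :=
  ∑ j : Fin n, ENNReal.ofReal (-(p j)) • Measure.dirac (-(lam j))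

theorem conv_Iio_eq_zero {μ ν : Measure ℝ} [SFinite ν] {a b : ℝ}
    (hμ : μ (Set.Iio a) = 0) (hν : ν (Set.Iio b) = 0) :
    (μ ∗ ν) (Set.Iio (a + b)) = 0 := by
  rw [Measure.conv, Measure.map_apply (by fun_prop) measurableSet_Iio]
  refine measure_mono_null (t := Set.Iio a ×ˢ Set.univ ∪ Set.univ ×ˢ Set.Iio b) ?_ ?_
  · rintro ⟨x, y⟩ hxy
    simp only [Set.mem_preimage, Set.mem_Iio] at hxy
    simp only [Set.mem_union, Set.mem_prod, Set.mem_Iio, Set.mem_univ, and_true, true_and]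
    by_contra! h
    linarith [h.1, h.2]
  · exact measure_union_null (by rw [Measure.prod_prod, hμ, zero_mul])
      (by rw [Measure.prod_prod, hν, mul_zero])

theorem conv_sum_right (μ : Measure ℝ) (ν : ℕ → Measure ℝ) [∀ k, SFinite (ν k)] :
    μ ∗ Measure.sum ν = Measure.sum fun k ↦ μ ∗ ν k := by
  simp only [Measure.conv]
  rw [Measure.prod_sum_right, Measure.map_sum (by fun_prop)]

theorem sum_eq_zero_add_sum_succ (ν : ℕ → Measure ℝ) :
    Measure.sum ν = ν 0 + Measure.sum fun k ↦ ν (k + 1) := by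
  ext s hs
  rw [Measure.add_apply, Measure.sum_apply _ hs, Measure.sum_apply _ hs, tsum_eq_zero_add']
  exact ENNReal.summable

theorem sum_Iio_eq_zero {ν : ℕ → Measure ℝ} {c ε : ℝ} (hε : 0 < ε)
    (hν : ∀ k : ℕ, ν k (Set.Iio (k * ε + c)) = 0) : Measure.sum ν (Set.Iio c) = 0 := by
  rw [Measure.sum_apply _ measurableSet_Iio, ENNReal.tsum_eq_zero]
  refine fun k ↦ measure_mono_null (Set.Iio_subset_Iio ?_) (hν k)
  have : 0 ≤ k * ε := by positivity
  linarith

theorem isLocallyFiniteMeasure_sum {ν : ℕ → Measure ℝ} [∀ k, IsFiniteMeasure (ν k)] {c ε : ℝ}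
    (hε : 0 < ε) (hν : ∀ k : ℕ, ν k (Set.Iio (k * ε + c)) = 0) :
    IsLocallyFiniteMeasure (Measure.sum ν) := by
  refine ⟨fun x ↦ ⟨Set.Iio (x + 1), Iio_mem_nhds (by linarith), ?_⟩⟩
  obtain ⟨K, hK⟩ := exists_nat_gt ((x + 1 - c) / ε)
  rw [div_lt_iff₀ hε] at hK
  rw [Measure.sum_apply _ measurableSet_Iio, tsum_eq_sum (s := Finset.range K)]
  · exact ENNReal.sum_lt_top.2 fun k _ ↦ measure_lt_top _ _
  · intro k hk
    have hKk : (K : ℝ) ≤ k := by exact_mod_cast not_lt.1 fun h ↦ hk (Finset.mem_range.2 h)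
    refine measure_mono_null (Set.Iio_subset_Iio ?_) (hν k)
    nlinarith

/-- The positive and negative parts of the terms of the Neumann series
`∑ (G ∗ (Q - R))ᵏ ∗ G` of the convolution inverse of `g + R - Q`, where `G` is the inverse
of `g`. -/
noncomputable def neumannTerm (G Q R : Measure ℝ) : ℕ → Measure ℝ × Measure ℝ
  | 0 => (G, 0)
  | k + 1 =>
    (G ∗ (Q ∗ (neumannTerm G Q R k).1 + R ∗ (neumannTerm G Q R k).2),
      G ∗ (Q ∗ (neumannTerm G Q R k).2 + R ∗ (neumannTerm G Q R k).1))

theorem neumannTerm_isFiniteMeasure (G Q R : Measure ℝ) [IsFiniteMeasure G] [IsFiniteMeasure Q]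
    [IsFiniteMeasure R] (k : ℕ) :
    IsFiniteMeasure (neumannTerm G Q R k).1 ∧ IsFiniteMeasure (neumannTerm G Q R k).2 := by
  induction k with
  | zero => exact ⟨‹_›, inferInstanceAs (IsFiniteMeasure (0 : Measure ℝ))⟩
  | succ k ih =>
    obtain ⟨h₁, h₂⟩ := ih
    simp only [neumannTerm]
    exact ⟨inferInstance, inferInstance⟩

theorem neumannTerm_Iio_eq_zero {G Q R : Measure ℝ} [IsFiniteMeasure G] [IsFiniteMeasure Q]
    [IsFiniteMeasure R] {m ε : ℝ} (hG : G (Set.Iio (-m)) = 0) (hQ : Q (Set.Iio (m + ε)) = 0)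
    (hR : R (Set.Iio (m + ε)) = 0) (k : ℕ) :
    (neumannTerm G Q R k).1 (Set.Iio (k * ε + -m)) = 0 ∧
      (neumannTerm G Q R k).2 (Set.Iio (k * ε + -m)) = 0 := by
  induction k with
  | zero => simpa [neumannTerm] using hG
  | succ k ih =>
    obtain ⟨h₁, h₂⟩ := ih
    obtain ⟨i₁, i₂⟩ := neumannTerm_isFiniteMeasure G Q R k
    have e : ((k + 1 : ℕ) : ℝ) * ε + -m = -m + ((m + ε) + (k * ε + -m)) := by push_cast; ring
    simp only [neumannTerm, e]
    constructor <;> refine conv_Iio_eq_zero hG ?_ <;> rw [Measure.add_apply, add_eq_zero]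
    · exact ⟨conv_Iio_eq_zero hQ h₁, conv_Iio_eq_zero hR h₂⟩
    · exact ⟨conv_Iio_eq_zero hQ h₂, conv_Iio_eq_zero hR h₁⟩

/-- If `g` has convolution inverse `G` and `Q`, `R` are supported strictly to the right of `m`,
while `G` is supported in `[-m, ∞)`, then `g + R - Q` has a convolution inverse. -/
theorem exists_conv_inverse {g G Q R : Measure ℝ} [IsFiniteMeasure g] [IsFiniteMeasure G]
    [IsFiniteMeasure Q] [IsFiniteMeasure R] {m ε : ℝ} (hε : 0 < ε)
    (hgG : g ∗ G = Measure.dirac 0) (hG : G (Set.Iio (-m)) = 0)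
    (hQ : Q (Set.Iio (m + ε)) = 0) (hR : R (Set.Iio (m + ε)) = 0) :
    ∃ S D : Measure ℝ, IsLocallyFiniteMeasure S ∧ IsLocallyFiniteMeasure D ∧
      (∃ a : ℝ, S (Set.Iio a) = 0) ∧ (∃ a : ℝ, D (Set.Iio a) = 0) ∧
      (g + R) ∗ S + Q ∗ D = Measure.dirac 0 + ((g + R) ∗ D + Q ∗ S) := by
  have := fun k ↦ (neumannTerm_isFiniteMeasure G Q R k).1
  have := fun k ↦ (neumannTerm_isFiniteMeasure G Q R k).2
  have hS := fun k ↦ (neumannTerm_Iio_eq_zero hG hQ hR k).1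
  have hD := fun k ↦ (neumannTerm_Iio_eq_zero hG hQ hR k).2
  have cancel (μ : Measure ℝ) [SFinite μ] : g ∗ (G ∗ μ) = μ := by
    rw [← Measure.conv_assoc, hgG, Measure.dirac_zero_conv]
  let S := Measure.sum fun k ↦ (neumannTerm G Q R k).1
  let D := Measure.sum fun k ↦ (neumannTerm G Q R k).2
  have hgS : g ∗ S = Measure.dirac 0 + (Q ∗ S + R ∗ D) := by
    simp only [S, D, conv_sum_right]
    rw [sum_eq_zero_add_sum_succ, Measure.sum_add_sum]
    simp only [neumannTerm, cancel, hgG]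
  have hgD : g ∗ D = Q ∗ D + R ∗ S := by
    simp only [S, D, conv_sum_right]
    rw [sum_eq_zero_add_sum_succ, Measure.sum_add_sum]
    simp only [neumannTerm, cancel, Measure.conv_zero, zero_add]
  refine ⟨S, D, isLocallyFiniteMeasure_sum hε hS, isLocallyFiniteMeasure_sum hε hD,
    ⟨-m, sum_Iio_eq_zero hε hS⟩, ⟨-m, sum_Iio_eq_zero hε hD⟩, ?_⟩
  rw [Measure.add_conv, Measure.add_conv, hgS, hgD]
  abel

theorem diracCombPos_neg {n : ℕ} (p lam : Fin n → ℝ) :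
    diracCombPos (-p) lam = diracCombNeg p lam := rfl

theorem diracCombNeg_neg {n : ℕ} (p lam : Fin n → ℝ) :
    diracCombNeg (-p) lam = diracCombPos p lam := by
  simp [diracCombNeg, diracCombPos]

instance diracCombPos_isFiniteMeasure {n : ℕ} (p lam : Fin n → ℝ) :
    IsFiniteMeasure (diracCombPos p lam) := by
  have (j : Fin n) : IsFiniteMeasure (ENNReal.ofReal (p j) • Measure.dirac (-(lam j))) :=
    Measure.smul_finite _ ENNReal.ofReal_ne_top
  unfold diracCombPos
  infer_instance

theorem diracCombPos_Iio_eq_zero {n : ℕ} {p lam : Fin n → ℝ} {a : ℝ}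
    (h : ∀ j, 0 < p j → a ≤ -lam j) : diracCombPos p lam (Set.Iio a) = 0 := by
  simp only [diracCombPos, Measure.coe_finsetSum, Finset.sum_apply, Measure.smul_apply,
    smul_eq_mul, Finset.sum_eq_zero_iff, Finset.mem_univ, true_imp_iff, mul_eq_zero,
    ENNReal.ofReal_eq_zero]
  intro j
  rcases le_or_gt (p j) 0 with hj | hj
  · exact .inl hj
  · right
    rw [Measure.dirac_apply' _ measurableSet_Iio]
    simpa using h j hj

theorem diracCombPos_eq_add_update {n : ℕ} (p lam : Fin n → ℝ) (i : Fin n) :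
    diracCombPos p lam = ENNReal.ofReal (p i) • Measure.dirac (-lam i) +
      diracCombPos (Function.update p i 0) lam := by
  simp only [diracCombPos]
  rw [← Finset.add_sum_erase _ _ (Finset.mem_univ i),
    ← Finset.add_sum_erase Finset.univ
      (fun j ↦ ENNReal.ofReal (Function.update p i 0 j) • Measure.dirac (-lam j))
      (Finset.mem_univ i)]
  simp only [Function.update_self, ENNReal.ofReal_zero, zero_smul, zero_add]
  congr 1
  refine Finset.sum_congr rfl fun j hj ↦ ?_
  rw [Function.update_of_ne (Finset.ne_of_mem_erase hj)]

theorem exists_diracComb_inverse_of_pos {n : ℕ} {p lam : Fin n → ℝ}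
    (hinj : Function.Injective lam) {i : Fin n} (hi : 0 < p i)
    (hmax : ∀ j, p j ≠ 0 → lam j ≤ lam i) :
    ∃ S D : Measure ℝ, IsLocallyFiniteMeasure S ∧ IsLocallyFiniteMeasure D ∧
      (∃ a : ℝ, S (Set.Iio a) = 0) ∧ (∃ a : ℝ, D (Set.Iio a) = 0) ∧
      (diracCombPos p lam) ∗ S + (diracCombNeg p lam) ∗ D =
        Measure.dirac 0 + ((diracCombPos p lam) ∗ D + (diracCombNeg p lam) ∗ S) := by
  obtain ⟨ε, hgap, hε⟩ : ∃ ε : ℝ, (∀ j, j ≠ i → p j ≠ 0 → ε ≤ lam i - lam j) ∧ 0 < ε := by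
    have : ∀ᶠ ε : ℝ in nhdsWithin 0 (Set.Ioi 0), ∀ j, j ≠ i → p j ≠ 0 → ε ≤ lam i - lam j := by
      refine Filter.eventually_all.2 fun j ↦ ?_
      by_cases hj : j ≠ i ∧ p j ≠ 0
      · have : 0 < lam i - lam j :=
          sub_pos.2 (lt_of_le_of_ne (hmax j hj.2) (hinj.ne hj.1))
        filter_upwards [Ioc_mem_nhdsGT this] with ε hε _ _ using hε.2
      · exact .of_forall fun ε h₁ h₂ ↦ (hj ⟨h₁, h₂⟩).elim
    exact (this.and self_mem_nhdsWithin).exists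
  have : IsFiniteMeasure (ENNReal.ofReal (p i) • Measure.dirac (-lam i)) :=
    Measure.smul_finite _ ENNReal.ofReal_ne_top
  have : IsFiniteMeasure (ENNReal.ofReal (p i)⁻¹ • Measure.dirac (lam i)) :=
    Measure.smul_finite _ ENNReal.ofReal_ne_top
  rw [diracCombPos_eq_add_update p lam i, ← diracCombPos_neg]
  refine exists_conv_inverse (G := ENNReal.ofReal (p i)⁻¹ • Measure.dirac (lam i))
    (m := -lam i) hε ?_ ?_ ?_ ?_
  · rw [Measure.conv_smul_left, Measure.conv_smul_right, Measure.dirac_conv_dirac, smul_smul,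
      ← ENNReal.ofReal_mul hi.le, mul_inv_cancel₀ hi.ne', ENNReal.ofReal_one, one_smul,
      neg_add_cancel]
  · rw [Measure.smul_apply, Measure.dirac_apply' _ measurableSet_Iio]
    simp
  · refine diracCombPos_Iio_eq_zero fun j hj ↦ ?_
    rw [Pi.neg_apply, neg_pos] at hj
    have := hgap j (by rintro rfl; exact hj.not_gt hi) hj.ne
    linarith
  · refine diracCombPos_Iio_eq_zero fun j hj ↦ ?_
    have hji : j ≠ i := by rintro rfl; simp at hj
    rw [Function.update_of_ne hji] at hj
    linarith [hgap j hji hj.ne']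

/-- Let `T > 0` and `p = ∑_{j=0}^{N} p_j δ_{-λ_j}` with `p_j ∈ ℝ` and pairwise
distinct `λ_j ∈ [0, T]`, and suppose `p_j λ_j ≠ 0` for some `j`.  Then `p` is invertible with
respect to convolution in the algebra `M₊(ℝ)` of Radon measures on `ℝ` whose support is bounded
on the left: there is `p⁻¹ ∈ M₊(ℝ)` with `p * p⁻¹ = δ₀`.

Here an element of `M₊(ℝ)` (a real Radon measure, locally finite, with support bounded on the
left) is represented by a pair `(q⁺, q⁻)` of locally finite nonnegative measures, each with
support bounded on the left, standing for `q = q⁺ - q⁻`; the signed convolution identity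
`p * q = δ₀` is encoded as the identity
`p⁺ ∗ q⁺ + p⁻ ∗ q⁻ = δ₀ + (p⁺ ∗ q⁻ + p⁻ ∗ q⁺)` between (nonnegative) measures. -/
theorem stmt_2 (T : ℝ) (hT : 0 < T) (N : ℕ) (p lam : Fin (N + 1) → ℝ)
    (hlam : ∀ j, lam j ∈ Set.Icc (0 : ℝ) T) (hinj : Function.Injective lam)
    (hp : ∃ j, p j * lam j ≠ 0) :
    ∃ qp qn : Measure ℝ,
      IsLocallyFiniteMeasure qp ∧ IsLocallyFiniteMeasure qn ∧
      (∃ a : ℝ, qp (Set.Iio a) = 0) ∧ (∃ a : ℝ, qn (Set.Iio a) = 0) ∧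
      (diracCombPos p lam).conv qp + (diracCombNeg p lam).conv qn =
        Measure.dirac 0 + ((diracCombPos p lam).conv qn + (diracCombNeg p lam).conv qp) := by
  obtain ⟨j₀, hj₀⟩ := hp
  obtain ⟨i, hi, hmax⟩ := Finset.exists_max_image (Finset.univ.filter fun j ↦ p j ≠ 0) lam
    ⟨j₀, by simpa using left_ne_zero_of_mul hj₀⟩
  simp only [Finset.mem_filter, Finset.mem_univ, true_and] at hi hmax
  rcases lt_or_gt_of_ne hi with hneg | hpos
  · obtain ⟨S, D, hS, hD, hSa, hDa, h⟩ := exists_diracComb_inverse_of_pos (p := -p) hinj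
      (by simpa using hneg) (fun j hj ↦ hmax j (by simpa using hj))
    rw [diracCombPos_neg, diracCombNeg_neg] at h
    refine ⟨D, S, hD, hS, hDa, hSa, ?_⟩
    rw [add_comm, h, add_comm (Measure.conv (diracCombNeg p lam) D)]
  · exact exists_diracComb_inverse_of_pos hinj hpos hmax
end

section
/- Let T > 0, let p_0, …, p_N ∈ ℝ and pairwise distinct λ_0, …, λ_N ∈ [0, T] be such that p_j λ_j ≠ 0 for some j and such that the coefficient p_j corresponding to the largest λ_j with p_j ≠ 0 is nonzero. If a continuous function γ : ℝ_+ → ℝ satisfies Σ_{j=0}^{N} p_j γ(t + λ_j) = 0 for all t ≥ 0 and γ vanishes identically on [0, T], then γ vanishes identically on ℝ_+. Consequently, on the space X^p of continuous solutions of this difference delay equation, the topology of uniform convergence on compact subsets of ℝ_+ coincides with the topology of the norm ‖γ‖_{[0,T]} = sup_{t ∈ [0,T]} |γ(t)|, and X^p endowed with ‖·‖_{[0,T]} is a Banach space. -/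
open MeasureTheory Set

/-- Extension of a continuous function on `ℝ₊ = [0, ∞)` to `ℝ` (by `0` on negative times,
where its values are irrelevant). -/
noncomputable def extFn (γ : C(Set.Ici (0 : ℝ), ℝ)) : ℝ → ℝ :=
  fun t => if h : (0 : ℝ) ≤ t then γ ⟨t, h⟩ else 0

/-- The set `X^p` of continuous solutions on `ℝ₊` of the difference delay equation
`∑_{j} p_j γ(t + λ_j) = 0`, `t ≥ 0`. -/
def XddeSet {n : ℕ} (p lam : Fin n → ℝ) : Set C(Set.Ici (0 : ℝ), ℝ) :=
  {γ | ∀ t : ℝ, 0 ≤ t → ∑ j : Fin n, p j * extFn γ (t + lam j) = 0}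

/-- Restriction of a continuous function on `[0, ∞)` to `[0, T]`. -/
noncomputable def restrictIcc (T : ℝ) (γ : C(Set.Ici (0 : ℝ), ℝ)) : C(Set.Icc (0 : ℝ) T, ℝ) :=
  γ.comp ⟨Set.inclusion (fun _ hx => hx.1), continuous_inclusion (fun _ hx => hx.1)⟩

open Filter Topology Uniformity

lemma extFn_of_nonneg (γ : C(Set.Ici (0 : ℝ), ℝ)) {t : ℝ} (ht : 0 ≤ t) :
    extFn γ t = γ ⟨t, ht⟩ := dif_pos ht

lemma extFn_sub (γ η : C(Set.Ici (0 : ℝ), ℝ)) (t : ℝ) :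
    extFn (γ - η) t = extFn γ t - extFn η t := by
  unfold extFn
  split_ifs <;> simp

lemma sub_mem_XddeSet {n : ℕ} {p lam : Fin n → ℝ} {γ η : C(Set.Ici (0 : ℝ), ℝ)}
    (hγ : γ ∈ XddeSet p lam) (hη : η ∈ XddeSet p lam) : γ - η ∈ XddeSet p lam := by
  intro t ht
  simp only [extFn_sub, mul_sub, Finset.sum_sub_distrib, hγ t ht, hη t ht, sub_zero]

/-- A gap below the strict maximum of a finite family. -/
lemma exists_gap {ι : Type*} [Finite ι] {lam : ι → ℝ} {j₀ : ι}
    (hlt : ∀ j, j ≠ j₀ → lam j < lam j₀) : ∃ δ > 0, ∀ j, j ≠ j₀ → lam j + δ ≤ lam j₀ := by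
  have h : ∀ᶠ δ : ℝ in 𝓝[>] 0, ∀ j, j ≠ j₀ → lam j + δ ≤ lam j₀ := by
    refine eventually_all.2 fun j => ?_
    by_cases hj : j = j₀
    · simp [hj]
    · filter_upwards [Ioo_mem_nhdsGT (sub_pos.2 (hlt j hj))] with δ hδ _
      linarith [hδ.2]
  obtain ⟨δ, hδ, hpos⟩ := (h.and self_mem_nhdsWithin).exists
  exact ⟨δ, hpos, hδ⟩

/-- Solving the delay equation for its leading term bounds it by the other terms. -/
lemma abs_leading_le {ι : Type*} [Fintype ι] {p v : ι → ℝ} {j₀ : ι}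
    (hp₀ : p j₀ ≠ 0) (hsum : ∑ j, p j * v j = 0) {B : ℝ} (hB : 0 ≤ B)
    (hv : ∀ j, j ≠ j₀ → |v j| ≤ B) : |v j₀| ≤ (1 + ∑ j, |p j| / |p j₀|) * B := by
  classical
  have hpos : 0 < |p j₀| := abs_pos.2 hp₀
  have hsplit := Finset.add_sum_erase Finset.univ (fun j => p j * v j) (Finset.mem_univ j₀)
  have heq : p j₀ * v j₀ = -∑ j ∈ Finset.univ.erase j₀, p j * v j := by
    linarith
  have hle : |p j₀| * |v j₀| ≤ (∑ j, |p j|) * B := by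
    rw [← abs_mul, heq, abs_neg, Finset.sum_mul]
    calc |∑ j ∈ Finset.univ.erase j₀, p j * v j|
        ≤ ∑ j ∈ Finset.univ.erase j₀, |p j * v j| := Finset.abs_sum_le_sum_abs _ _
      _ ≤ ∑ j ∈ Finset.univ.erase j₀, |p j| * B := by
          refine Finset.sum_le_sum fun j hj => ?_
          rw [abs_mul]
          exact mul_le_mul_of_nonneg_left (hv j (Finset.ne_of_mem_erase hj)) (abs_nonneg _)
      _ ≤ ∑ j, |p j| * B :=
          Finset.sum_le_sum_of_subset_of_nonneg (Finset.erase_subset _ _)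
            fun j _ _ => mul_nonneg (abs_nonneg _) hB
  rw [← Finset.sum_div]
  calc |v j₀| ≤ (∑ j, |p j|) * B / |p j₀| := by rw [le_div_iff₀ hpos]; linarith
    _ ≤ (1 + (∑ j, |p j|) / |p j₀|) * B := by
        rw [mul_div_right_comm]
        linarith

/-- Solutions of the delay equation are bounded on `[0, R]` by a multiple of any bound on
`[0, T]`, uniformly over all solutions. -/
lemma exists_bound_of_mem_XddeSet {n : ℕ} {p lam : Fin n → ℝ} {T : ℝ} {j₀ : Fin n}
    (hlam : ∀ j, lam j ∈ Set.Icc (0 : ℝ) T) (hp₀ : p j₀ ≠ 0)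
    (hlt : ∀ j, j ≠ j₀ → lam j < lam j₀) (R : ℝ) :
    ∃ K : ℝ, 0 ≤ K ∧ ∀ γ ∈ XddeSet p lam, ∀ M : ℝ, 0 ≤ M →
      (∀ t, 0 ≤ t → t ≤ T → |extFn γ t| ≤ M) →
      ∀ t, 0 ≤ t → t ≤ R → |extFn γ t| ≤ K * M := by
  obtain ⟨δ, hδ, hgap⟩ := exists_gap hlt
  set C : ℝ := 1 + ∑ j, |p j| / |p j₀| with hC
  have hC1 : 1 ≤ C := by
    have : 0 ≤ ∑ j, |p j| / |p j₀| := Finset.sum_nonneg fun j _ => by positivity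
    linarith
  have step : ∀ m : ℕ, ∀ γ ∈ XddeSet p lam, ∀ M : ℝ, 0 ≤ M →
      (∀ t, 0 ≤ t → t ≤ T → |extFn γ t| ≤ M) →
      ∀ t, 0 ≤ t → t ≤ T + m * δ → |extFn γ t| ≤ C ^ m * M := by
    intro m γ hγ M hM hbd
    induction m with
    | zero => simpa using hbd
    | succ m ih =>
      intro t ht htm
      have hB : 0 ≤ C ^ m * M := by positivity
      rw [pow_succ', mul_assoc]
      push_cast at htm
      by_cases htT : t ≤ T + m * δ
      · exact (ih t ht htT).trans (le_mul_of_one_le_left hB hC1)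
      · have hm : 0 ≤ (m : ℝ) * δ := by positivity
        have hs : 0 ≤ t - lam j₀ := by linarith [(hlam j₀).2]
        have key := abs_leading_le (v := fun j => extFn γ (t - lam j₀ + lam j)) hp₀ (hγ _ hs) hB
          fun j hj => ih _ (by linarith [(hlam j).1]) (by linarith [hgap j hj])
        simpa using key
  obtain ⟨m, hm⟩ := exists_nat_ge ((R - T) / δ)
  rw [div_le_iff₀ hδ] at hm
  exact ⟨C ^ m, by positivity, fun γ hγ M hM hbd t ht htR =>
    step m γ hγ M hM hbd t ht (by linarith)⟩

lemma isClosed_XddeSet {n : ℕ} {p lam : Fin n → ℝ} (hlam : ∀ j, 0 ≤ lam j) :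
    IsClosed (XddeSet p lam) := by
  simp only [XddeSet, Set.ofPred_forall]
  refine isClosed_iInter fun t => isClosed_iInter fun ht =>
    isClosed_eq (continuous_finsetSum _ fun j _ => continuous_const.mul ?_) continuous_const
  simp only [extFn_of_nonneg _ (add_nonneg ht (hlam j))]
  exact continuous_eval_const _

lemma isUniformInducing_restrictIcc {n : ℕ} {p lam : Fin n → ℝ} {T : ℝ} {j₀ : Fin n}
    (hlam : ∀ j, lam j ∈ Set.Icc (0 : ℝ) T) (hp₀ : p j₀ ≠ 0)
    (hlt : ∀ j, j ≠ j₀ → lam j < lam j₀) :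
    IsUniformInducing (fun γ : ↥(XddeSet p lam) => restrictIcc T γ.1) := by
  refine isUniformInducing_iff'.2
    ⟨(ContinuousMap.uniformContinuous_comp_left _).comp uniformContinuous_subtype_val, ?_⟩
  rw [uniformity_subtype]
  intro U hU
  obtain ⟨V, hV, hVU⟩ := hU
  obtain ⟨S, W, hS, hW, hSW⟩ := (ContinuousMap.mem_compactConvergence_entourage_iff V).1 hV
  obtain ⟨ε, hε, hεW⟩ := Metric.mem_uniformity_dist.1 hW
  obtain ⟨R, hR⟩ := (hS.image continuous_subtype_val).bddAbove
  obtain ⟨K, hK, hbound⟩ := exists_bound_of_mem_XddeSet hlam hp₀ hlt R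
  have hη : 0 < ε / (K + 1) := by positivity
  refine ⟨_, Metric.dist_mem_uniformity hη, ?_⟩
  rintro ⟨γ, η⟩ hγη
  refine hVU (hSW fun x hx => hεW ?_)
  have hd : dist (restrictIcc T γ.1) (restrictIcc T η.1) < ε / (K + 1) := hγη
  have h := hbound _ (sub_mem_XddeSet γ.2 η.2) (ε / (K + 1)) hη.le
    (fun t ht htT => by
      rw [extFn_of_nonneg _ ht]
      exact ((ContinuousMap.dist_apply_le_dist (⟨t, ht, htT⟩ : Set.Icc (0 : ℝ) T)).trans_lt hd).le)
    x x.2 (hR ⟨x, hx, rfl⟩)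
  rw [extFn_of_nonneg _ x.2] at h
  have hlt' : K * (ε / (K + 1)) < ε := by
    rw [← mul_div_assoc, div_lt_iff₀ (by positivity)]
    linarith [mul_comm K ε]
  exact lt_of_le_of_lt h hlt'

/-- Let `T > 0`, `p_j ∈ ℝ`, pairwise distinct `λ_j ∈ [0, T]`, with
`p_j λ_j ≠ 0` for some `j`, and the coefficient corresponding to the largest `λ_j` nonzero.
(1) If a continuous `γ : ℝ₊ → ℝ` solves the difference delay equation
`∑_j p_j γ(t + λ_j) = 0` (`t ≥ 0`) and vanishes on `[0, T]`, it vanishes identically.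
(2) Consequently, on the space `X^p` of continuous solutions, the topology of uniform
convergence on compact subsets of `ℝ₊` (i.e. the compact-open topology) coincides with the
topology induced by the norm `‖γ‖_{[0,T]} = sup_{[0,T]} |γ|` (i.e. the topology pulled back by
the restriction map to `C([0,T])` with its sup norm), and
(3) `X^p` with this norm (uniformity) is complete, i.e. a Banach space. -/
theorem stmt_5 (T : ℝ) (hT : 0 < T) (N : ℕ) (p lam : Fin (N + 1) → ℝ)
    (hlam : ∀ j, lam j ∈ Set.Icc (0 : ℝ) T) (hinj : Function.Injective lam)
    (hp : ∃ j, p j * lam j ≠ 0)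
    (hlead : ∃ j0, p j0 ≠ 0 ∧ ∀ j, lam j ≤ lam j0) :
    (∀ γ ∈ XddeSet p lam, (∀ t : Set.Ici (0 : ℝ), (t : ℝ) ≤ T → γ t = 0) → γ = 0) ∧
    ((inferInstance : TopologicalSpace ↥(XddeSet p lam)) =
      TopologicalSpace.induced (fun γ : ↥(XddeSet p lam) => restrictIcc T γ.1)
        inferInstance) ∧
    @CompleteSpace ↥(XddeSet p lam)
      (UniformSpace.comap (fun γ : ↥(XddeSet p lam) => restrictIcc T γ.1) inferInstance) := by
  obtain ⟨j₀, hp₀, hmax⟩ := hlead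
  have hlt : ∀ j, j ≠ j₀ → lam j < lam j₀ := fun j hj =>
    lt_of_le_of_ne (hmax j) fun h => hj (hinj h)
  have hind := isUniformInducing_restrictIcc hlam hp₀ hlt
  refine ⟨fun γ hγ hzero => ?_, hind.isInducing.eq_induced, ?_⟩
  · ext x
    obtain ⟨K, -, hbound⟩ := exists_bound_of_mem_XddeSet hlam hp₀ hlt x
    have h := hbound γ hγ 0 le_rfl
      (fun t ht htT => by rw [extFn_of_nonneg _ ht, hzero ⟨t, ht⟩ htT, abs_zero]) x x.2 le_rfl
    rw [mul_zero, extFn_of_nonneg _ x.2] at h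
    exact abs_nonpos_iff.1 h
  · rw [hind.comap_uniformSpace]
    have : LocallyCompactSpace (Set.Ici (0 : ℝ)) := isClosed_Ici.locallyCompactSpace
    exact (isClosed_XddeSet fun j => (hlam j).1).completeSpace_coe
end
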